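/- The relation ≤ is a partial order on φ(V_D): it is reflexive, transitive, and antisymmetric. -/

import Mathlib

open scoped BigOperators

/-- `W D` : functions `Z/(D+1) → F₂`. -/
abbrev Wsp (D : ℕ) : Type := ZMod (D + 1) → ZMod 2

/-- The all-ones function. -/
def allOnes (D : ℕ) : Wsp D := fun _ => 1

/-- `V D = W/span{u}`. -/
abbrev Vsp (D : ℕ) : Type := Wsp D ⧸ Submodule.span (ZMod 2) {allOnes D}

/-- `e i` : image of the standard basis function at `i`. -/
def eV (D : ℕ) (i : ZMod (D + 1)) : Vsp D :=
  Submodule.Quotient.mk (Pi.single i 1)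

/-- `e_I = ∑_{s ∈ I} e_s`. -/
def eSet (D : ℕ) (I : Finset (ZMod (D + 1))) : Vsp D := ∑ s ∈ I, eV D s

/-- A cyclic interval (arc): nonempty proper subset of the form `{i, i+1, …, j}`. -/
def IsInterval (D : ℕ) (I : Finset (ZMod (D + 1))) : Prop :=
  ∃ (i : ZMod (D + 1)) (l : ℕ), 1 ≤ l ∧ l ≤ D ∧
    I = (Finset.range l).image (fun t : ℕ => i + (t : ZMod (D + 1)))

/-- Member of `ℐ¹` : interval of odd cardinality. -/
def OddInterval (D : ℕ) (I : Finset (ZMod (D + 1))) : Prop :=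
  IsInterval D I ∧ Odd I.card

/-- `I ≺ I'` : `I ⊊ I'` and `I' − I` is a disjoint union of two intervals. -/
def Prec (D : ℕ) (I I' : Finset (ZMod (D + 1))) : Prop :=
  I ⊂ I' ∧ ∃ I₁ I₂, IsInterval D I₁ ∧ IsInterval D I₂ ∧ Disjoint I₁ I₂ ∧ I' \ I = I₁ ∪ I₂

/-- `I ♠ I'` : `I ∩ I' = ∅` and `I ∪ I'` is not an interval. -/
def Spade (D : ℕ) (I I' : Finset (ZMod (D + 1))) : Prop :=
  I ∩ I' = ∅ ∧ ¬ IsInterval D (I ∪ I')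

/-- `I^ev`. -/
noncomputable def evSet (D : ℕ) (I : Finset (ZMod (D + 1))) : Finset (ZMod (D + 1)) :=
  @Finset.filter _
    (fun i => ∃ I' I'', OddInterval D I' ∧ OddInterval D I'' ∧ Spade D I' I'' ∧
      I.erase i = I' ∪ I'')
    (Classical.decPred _) I

/-- `B ∈ φ(V_D)` : a finite set of elements of `ℐ¹` satisfying (P0) and (P1). -/
def phi (D : ℕ) (B : Finset (Finset (ZMod (D + 1)))) : Prop :=
  (∀ I ∈ B, OddInterval D I) ∧
  (∀ I ∈ B, ∀ I' ∈ B, I = I' ∨ Spade D I I' ∨ Prec D I I' ∨ Prec D I' I) ∧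
  (∀ I ∈ B, ∃ 𝒥 : Finset (Finset (ZMod (D + 1))), 𝒥 ⊆ B ∧
    (∀ J ∈ 𝒥, Prec D J I) ∧
    (∀ J ∈ 𝒥, ∀ J' ∈ 𝒥, J ≠ J' → Disjoint J J') ∧
    evSet D I ⊆ 𝒥.biUnion id)

/-- `⟨B⟩` : the F₂-span of `{e_I : I ∈ B}`. -/
def spanB (D : ℕ) (B : Finset (Finset (ZMod (D + 1)))) : Submodule (ZMod 2) (Vsp D) :=
  Submodule.span (ZMod 2) (eSet D '' ↑B)

/-- `g_i(B) = |{I ∈ B : i ∈ I}|`. -/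
def gB (D : ℕ) (B : Finset (Finset (ZMod (D + 1)))) (i : ZMod (D + 1)) : ℕ :=
  (B.filter (fun I => i ∈ I)).card

/-- `ε(B) = ∑_i (g_i(B)(g_i(B)+1)/2 mod 2) e_i`. -/
def epsB (D : ℕ) (B : Finset (Finset (ZMod (D + 1)))) : Vsp D :=
  ∑ i : ZMod (D + 1), ((gB D B i * (gB D B i + 1) / 2 : ℕ) : ZMod 2) • eV D i

/-- The partial order `B' ≤ B` on `φ(V_D)`. -/
def leφ (D : ℕ) (B' B : Finset (Finset (ZMod (D + 1)))) : Prop :=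
  ∃ (k : ℕ) (c : ℕ → Finset (Finset (ZMod (D + 1)))),
    c 0 = B' ∧ c k = B ∧ (∀ s ≤ k, phi D (c s)) ∧
    ∀ s < k, epsB D (c s) ∈ spanB D (c (s + 1))

/-- `B' < B`. -/
def ltφ (D : ℕ) (B' B : Finset (Finset (ZMod (D + 1)))) : Prop :=
  leφ D B' B ∧ B' ≠ B

/-- `1_E ∈ ℂ[V_D]`, the indicator function of `E ⊆ V_D`. -/
noncomputable def ind (D : ℕ) (E : Set (Vsp D)) : Vsp D → ℂ := E.indicator 1

/-- `δ_x ∈ ℂ[V_D]`. -/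
noncomputable def delta (D : ℕ) (x : Vsp D) : Vsp D → ℂ := ind D {x}

/-- The symplectic form on `W`. -/
def formW (D : ℕ) (x y : Wsp D) : ZMod 2 :=
  ∑ i : ZMod (D + 1), (x i * y (i + 1) + x (i + 1) * y i)

/-- The induced symplectic form on `V_D` (well defined since the form kills `u`). -/
noncomputable def formV (D : ℕ) (x y : Vsp D) : ZMod 2 :=
  formW D (Quotient.out x) (Quotient.out y)

/-- The Fourier transform `ℂ[V_D] → ℂ[V_D]`. -/
noncomputable def fourierV (D : ℕ) (f : Vsp D → ℂ) : Vsp D → ℂ :=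
  fun y => (2 : ℂ) ^ (-((D / 2 : ℕ) : ℤ)) *
    ∑ᶠ x : Vsp D, (if formV D x y = 0 then (1 : ℂ) else -1) * f x

/-- The target in `V_D` of the basis vector `e'_ℓ` of `V_{D-2}` under `τ_j`. -/
noncomputable def tauTgt (D j : ℕ) (ℓ : ZMod (D - 2 + 1)) : Vsp D :=
  let L : ℕ := if ℓ.val = 0 then D - 1 else ℓ.val
  if ℓ = ((j - 1 : ℕ) : ZMod (D - 2 + 1)) then
    eV D ((j : ZMod (D + 1)) - 1) + eV D (j : ZMod (D + 1)) + eV D ((j : ZMod (D + 1)) + 1)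
  else if L < j - 1 then eV D (L : ZMod (D + 1))
  else eV D ((L + 2 : ℕ) : ZMod (D + 1))

/-- The linear embedding `τ_j : V_{D-2} → V_D` (well defined independently of the chosen
representative since the targets sum to `0`). -/
noncomputable def tauMap (D j : ℕ) (x : Vsp (D - 2)) : Vsp D :=
  ∑ i : ZMod (D - 2 + 1), (Quotient.out x) i • tauTgt D j i

section Arcs

variable {D : ℕ}

/-- The arc `{i, i+1, …, i+l-1}`. -/
def arc (D : ℕ) (i : ZMod (D + 1)) (l : ℕ) : Finset (ZMod (D + 1)) :=
  (Finset.range l).image (fun t : ℕ => i + (t : ZMod (D + 1)))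

theorem val_natCast_of_le {t : ℕ} (ht : t ≤ D) : (t : ZMod (D + 1)).val = t :=
  ZMod.val_cast_of_lt (by omega)

theorem val_add_one_eq_ite (y : ZMod (D + 1)) :
    (y + 1).val = if y.val = D then 0 else y.val + 1 := by
  have hy := ZMod.val_lt y
  have h : y + 1 = ((y.val + 1 : ℕ) : ZMod (D + 1)) := by
    push_cast
    rw [ZMod.natCast_zmod_val]
  rw [h]
  split_ifs with hD
  · rw [hD, ZMod.natCast_self, ZMod.val_zero]
  · exact val_natCast_of_le (by omega)

theorem mem_arc {i x : ZMod (D + 1)} {l : ℕ} (hl : l ≤ D + 1) :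
    x ∈ arc D i l ↔ (x - i).val < l := by
  simp only [arc, Finset.mem_image, Finset.mem_range]
  constructor
  · rintro ⟨t, ht, rfl⟩
    rw [add_sub_cancel_left, val_natCast_of_le (by omega)]
    exact ht
  · intro h
    exact ⟨_, h, by rw [ZMod.natCast_zmod_val]; ring⟩

theorem add_natCast_mem_arc {i : ZMod (D + 1)} {l t : ℕ} (ht : t < l) :
    i + (t : ZMod (D + 1)) ∈ arc D i l :=
  Finset.mem_image.2 ⟨t, Finset.mem_range.2 ht, rfl⟩

theorem card_arc {i : ZMod (D + 1)} {l : ℕ} (hl : l ≤ D + 1) : (arc D i l).card = l := by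
  rw [arc, Finset.card_image_of_injOn, Finset.card_range]
  intro s hs t ht h
  simp only [Finset.coe_range, Set.mem_Iio] at hs ht
  have h' := congrArg ZMod.val (add_left_cancel h)
  rwa [val_natCast_of_le (by omega), val_natCast_of_le (by omega)] at h'

theorem arc_union_arc (i : ZMod (D + 1)) (k l : ℕ) :
    arc D i k ∪ arc D (i + k) l = arc D i (k + l) := by
  ext x
  simp only [arc, Finset.mem_union, Finset.mem_image, Finset.mem_range]
  constructor
  · rintro (⟨t, ht, rfl⟩ | ⟨t, ht, rfl⟩)
    · exact ⟨t, by omega, rfl⟩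
    · exact ⟨k + t, by omega, by push_cast; ring⟩
  · rintro ⟨t, ht, rfl⟩
    by_cases h : t < k
    · exact Or.inl ⟨t, h, rfl⟩
    · refine Or.inr ⟨t - k, by omega, ?_⟩
      rw [Nat.cast_sub (by omega)]
      ring

theorem isInterval_arc {i : ZMod (D + 1)} {l : ℕ} (h1 : 1 ≤ l) (hl : l ≤ D) :
    IsInterval D (arc D i l) := ⟨i, l, h1, hl, rfl⟩

theorem oddInterval_arc {i : ZMod (D + 1)} {l : ℕ} (ho : Odd l) (hl : l ≤ D) :
    OddInterval D (arc D i l) :=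
  ⟨isInterval_arc ho.pos hl, by rwa [card_arc (by omega)]⟩

theorem OddInterval.exists_arc {I : Finset (ZMod (D + 1))} (h : OddInterval D I) :
    ∃ i l, Odd l ∧ l ≤ D ∧ I = arc D i l := by
  obtain ⟨⟨i, l, -, hl, rfl⟩, ho⟩ := h
  change Odd (arc D i l).card at ho
  rw [card_arc (by omega)] at ho
  exact ⟨i, l, ho, hl, rfl⟩

theorem arc_start {i n : ZMod (D + 1)} {l : ℕ} (hl : l ≤ D + 1)
    (hn : n ∉ arc D i l) (hn' : n + 1 ∈ arc D i l) : i = n + 1 := by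
  rw [mem_arc hl] at hn hn'
  rw [show n + 1 - i = n - i + 1 by ring, val_add_one_eq_ite] at hn'
  split_ifs at hn' with h
  · have h0 : (n - i + 1).val = 0 := by rw [val_add_one_eq_ite, if_pos h]
    rw [ZMod.val_eq_zero] at h0
    linear_combination -h0
  · omega

theorem arc_end {i n : ZMod (D + 1)} {l : ℕ} (hl : l ≤ D + 1)
    (hn : n ∈ arc D i l) (hn' : n + 1 ∉ arc D i l) : i + l = n + 1 := by
  rw [mem_arc hl] at hn hn'
  rw [show n + 1 - i = n - i + 1 by ring, val_add_one_eq_ite] at hn'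
  have h : l = (n - i).val + 1 := by
    split_ifs at hn' with h <;> omega
  rw [h]
  push_cast
  rw [ZMod.natCast_zmod_val]
  ring

theorem sub_one_notMem_arc {i : ZMod (D + 1)} {l : ℕ} (hl : l ≤ D) : i - 1 ∉ arc D i l := by
  rw [mem_arc (by omega)]
  have h := val_add_one_eq_ite (i - 1 - i)
  rw [show i - 1 - i + 1 = 0 by ring, ZMod.val_zero] at h
  split_ifs at h
  omega

theorem add_length_notMem_arc {i : ZMod (D + 1)} {l : ℕ} (hl : l ≤ D) :
    i + (l : ZMod (D + 1)) ∉ arc D i l := by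
  rw [mem_arc (by omega), add_sub_cancel_left, val_natCast_of_le hl]
  exact lt_irrefl l

/-- Disjoint odd intervals that touch have an interval as their union. -/
theorem isInterval_union_of_touching (hDev : Even D) {A C : Finset (ZMod (D + 1))}
    (hA : OddInterval D A) (hC : OddInterval D C) (hAC : Disjoint A C) {n : ZMod (D + 1)}
    (hn : n ∈ A) (hn' : n + 1 ∈ C) : IsInterval D (A ∪ C) := by
  obtain ⟨i, k, hk, hkD, rfl⟩ := hA.exists_arc
  obtain ⟨j, l, hl, hlD, rfl⟩ := hC.exists_arc
  have h1 := arc_end (by omega) hn (Finset.disjoint_right.1 hAC hn')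
  have h2 := arc_start (by omega) (Finset.disjoint_left.1 hAC hn) hn'
  have hcard := Finset.card_union_of_disjoint hAC
  rw [card_arc (by omega), card_arc (by omega)] at hcard
  have hle := Finset.card_le_univ (arc D i k ∪ arc D j l)
  rw [ZMod.card] at hle
  rw [h2, ← h1, arc_union_arc]
  refine isInterval_arc (by have := hk.pos; omega) ?_
  obtain ⟨a, rfl⟩ := hk
  obtain ⟨b, rfl⟩ := hl
  obtain ⟨d, rfl⟩ := hDev
  omega

/-- The elements of an odd interval at (zero-based) odd positions belong to `I^ev`. -/
theorem mem_evSet_arc {i : ZMod (D + 1)} {l t : ℕ} (hl : Odd l) (hlD : l ≤ D)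
    (ht : Odd t) (htl : t < l) : i + (t : ZMod (D + 1)) ∈ evSet D (arc D i l) := by
  have hlt : t + 1 < l := by
    obtain ⟨a, rfl⟩ := hl
    obtain ⟨b, rfl⟩ := ht
    omega
  have hr : Odd (l - (t + 1)) := by
    obtain ⟨a, rfl⟩ := hl
    obtain ⟨b, rfl⟩ := ht
    exact ⟨a - b - 1, by omega⟩
  have herase : (arc D i l).erase (i + t) =
      arc D i t ∪ arc D (i + ((t + 1 : ℕ) : ZMod (D + 1))) (l - (t + 1)) := by
    ext x
    simp only [arc, Finset.mem_erase, Finset.mem_union, Finset.mem_image, Finset.mem_range]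
    constructor
    · rintro ⟨hx, s, hs, rfl⟩
      have hst : s ≠ t := by rintro rfl; exact hx rfl
      by_cases h : s < t
      · exact Or.inl ⟨s, h, rfl⟩
      · refine Or.inr ⟨s - (t + 1), by omega, ?_⟩
        rw [add_assoc, ← Nat.cast_add]
        congr 2
        omega
    · have key : ∀ s, s < l → s ≠ t → i + (s : ZMod (D + 1)) ≠ i + t := by
        intro s hs hst h
        have h' := congrArg ZMod.val (add_left_cancel h)
        rw [val_natCast_of_le (by omega), val_natCast_of_le (by omega)] at h'
        exact hst h'
      rintro (⟨s, hs, rfl⟩ | ⟨s, hs, rfl⟩)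
      · exact ⟨key s (by omega) (by omega), s, by omega, rfl⟩
      · rw [add_assoc, ← Nat.cast_add]
        exact ⟨key _ (by omega) (by omega), _, by omega, rfl⟩
  refine (@Finset.mem_filter _ _ (Classical.decPred _) _ _).2 ⟨add_natCast_mem_arc htl, _, _, oddInterval_arc ht (by omega),
    oddInterval_arc hr (by omega), ⟨?_, ?_⟩, herase⟩
  · rw [← Finset.disjoint_iff_inter_eq_empty, Finset.disjoint_left]
    intro x hx hx'
    simp only [arc, Finset.mem_image, Finset.mem_range] at hx hx'
    obtain ⟨s, hs, rfl⟩ := hx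
    obtain ⟨r, hr, h⟩ := hx'
    rw [add_assoc, ← Nat.cast_add] at h
    have h' := congrArg ZMod.val (add_left_cancel h)
    rw [val_natCast_of_le (by omega), val_natCast_of_le (by omega)] at h'
    omega
  · rw [← herase]
    rintro ⟨j, k, -, hkD, h⟩
    change _ = arc D j k at h
    have hne : ∀ s, s ≤ D → s ≠ 0 → i + (s : ZMod (D + 1)) ≠ i := by
      intro s hs hs0 h
      have h' := congrArg ZMod.val (add_eq_left.1 h)
      rw [val_natCast_of_le hs, ZMod.val_zero] at h'
      exact hs0 h'
    have h1 : j = i - 1 + 1 := by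
      refine arc_start (l := k) (by omega) ?_ ?_
      · rw [← h]
        exact fun hx => sub_one_notMem_arc hlD (Finset.mem_of_mem_erase hx)
      · rw [← h, sub_add_cancel, Finset.mem_erase]
        refine ⟨(hne t (by omega) (by have := ht.pos; omega)).symm, ?_⟩
        simpa using add_natCast_mem_arc (D := D) (i := i) (t := 0) (l := l) (by omega)
    have h2 : j = i + t + 1 := by
      refine arc_start (l := k) (by omega) ?_ ?_
      · rw [← h]
        exact Finset.notMem_erase _ _
      · have h3 : i + (t : ZMod (D + 1)) + 1 = i + ((t + 1 : ℕ) : ZMod (D + 1)) := by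
          push_cast; ring
        rw [← h, herase, h3]
        refine Finset.mem_union_right _ ?_
        simpa using add_natCast_mem_arc (D := D) (i := i + ((t + 1 : ℕ) : ZMod (D + 1)))
          (t := 0) (l := l - (t + 1)) (by omega)
    refine hne (t + 1) (by omega) (by omega) ?_
    push_cast
    rw [← add_assoc, ← h2, h1]
    ring

/-- Of two consecutive elements of an odd interval, one lies in `I^ev`. -/
theorem mem_evSet_or_add_one_mem {I : Finset (ZMod (D + 1))} (hI : OddInterval D I)
    {n : ZMod (D + 1)} (hn : n ∈ I) (hn' : n + 1 ∈ I) : n ∈ evSet D I ∨ n + 1 ∈ evSet D I := by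
  obtain ⟨i, l, hl, hlD, rfl⟩ := hI.exists_arc
  rw [mem_arc (by omega)] at hn hn'
  have hx : ∀ x : ZMod (D + 1), (x - i).val < l → Odd (x - i).val → x ∈ evSet D (arc D i l) := by
    intro x h ho
    have := mem_evSet_arc (i := i) hl hlD ho h
    rwa [ZMod.natCast_zmod_val, add_sub_cancel] at this
  rcases Nat.even_or_odd (n - i).val with he | ho
  · refine Or.inr (hx _ hn' ?_)
    rw [show n + 1 - i = n - i + 1 by ring, val_add_one_eq_ite, if_neg (by omega)]
    exact he.add_one
  · exact Or.inl (hx _ hn ho)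

/-- If an odd interval `K` properly contained in `J` starts where `J` starts, the element after
`K` is in `J^ev`. -/
theorem exists_next_mem_evSet {K J : Finset (ZMod (D + 1))} (hK : OddInterval D K)
    (hJ : OddInterval D J) (hKJ : K ⊂ J) {n : ZMod (D + 1)} (hnJ : n ∉ J) (hnK : n + 1 ∈ K) :
    ∃ m, m ∈ K ∧ m + 1 ∉ K ∧ m + 1 ∈ evSet D J := by
  have hcard := Finset.card_lt_card hKJ
  obtain ⟨i, k, hk, hkD, rfl⟩ := hK.exists_arc
  obtain ⟨j, l, hl, hlD, rfl⟩ := hJ.exists_arc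
  rw [card_arc (by omega), card_arc (by omega)] at hcard
  have h1 := arc_start (by omega) hnJ (hKJ.1 hnK)
  have h2 := arc_start (by omega) (fun h => hnJ (hKJ.1 h)) hnK
  have hm : i + ((k - 1 : ℕ) : ZMod (D + 1)) + 1 = i + k := by
    rw [Nat.cast_sub hk.pos]
    push_cast
    ring
  refine ⟨i + ((k - 1 : ℕ) : ZMod (D + 1)), add_natCast_mem_arc (by have := hk.pos; omega), ?_, ?_⟩
  · rw [hm]
    exact add_length_notMem_arc hkD
  · rw [hm, h2, ← h1]
    exact mem_evSet_arc hl hlD hk hcard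

/-- If an odd interval `K` properly contained in `J` ends where `J` ends, the element before
`K` is in `J^ev`. -/
theorem exists_prev_mem_evSet {K J : Finset (ZMod (D + 1))} (hK : OddInterval D K)
    (hJ : OddInterval D J) (hKJ : K ⊂ J) {n : ZMod (D + 1)} (hnJ : n + 1 ∉ J) (hnK : n ∈ K) :
    ∃ m, m + 1 ∈ K ∧ m ∉ K ∧ m ∈ evSet D J := by
  have hcard := Finset.card_lt_card hKJ
  obtain ⟨i, k, hk, hkD, rfl⟩ := hK.exists_arc
  obtain ⟨j, l, hl, hlD, rfl⟩ := hJ.exists_arc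
  rw [card_arc (by omega), card_arc (by omega)] at hcard
  have h1 := arc_end (by omega) (hKJ.1 hnK) hnJ
  have h2 := arc_end (by omega) hnK (fun h => hnJ (hKJ.1 h))
  have hi : i - 1 = j + ((l - k - 1 : ℕ) : ZMod (D + 1)) := by
    rw [Nat.cast_sub (by omega), Nat.cast_sub (by omega)]
    push_cast
    linear_combination h2 - h1
  refine ⟨i - 1, ?_, sub_one_notMem_arc hkD, ?_⟩
  · simpa using add_natCast_mem_arc (D := D) (i := i) (t := 0) (l := k) hk.pos
  · rw [hi]
    refine mem_evSet_arc hl hlD ?_ (by omega)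
    obtain ⟨a, rfl⟩ := hk
    obtain ⟨b, rfl⟩ := hl
    exact ⟨b - a - 1, by omega⟩

end Arcs

section Families

variable {D : ℕ} {B : Finset (Finset (ZMod (D + 1)))}

/-- The members of `B` containing `n`. -/
def fam (B : Finset (Finset (ZMod (D + 1)))) (n : ZMod (D + 1)) :
    Finset (Finset (ZMod (D + 1))) := B.filter (fun I => n ∈ I)

/-- The members of `B` properly containing `I`. -/
def supers (B : Finset (Finset (ZMod (D + 1)))) (I : Finset (ZMod (D + 1))) :
    Finset (Finset (ZMod (D + 1))) := B.filter (fun J => I ⊂ J)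

theorem mem_fam {n : ZMod (D + 1)} {I : Finset (ZMod (D + 1))} : I ∈ fam B n ↔ I ∈ B ∧ n ∈ I :=
  Finset.mem_filter

theorem mem_supers {I J : Finset (ZMod (D + 1))} : J ∈ supers B I ↔ J ∈ B ∧ I ⊂ J :=
  Finset.mem_filter

theorem notMem_supers_self (I : Finset (ZMod (D + 1))) : I ∉ supers B I :=
  fun h => (mem_supers.1 h).2.ne rfl

theorem phi.comparable (hDev : Even D) (hB : phi D B) {I J : Finset (ZMod (D + 1))}
    (hI : I ∈ B) (hJ : J ∈ B) {n : ZMod (D + 1)} (hn : n ∈ I) (h : n ∈ J ∨ n + 1 ∈ J) :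
    I ⊂ J ∨ I = J ∨ J ⊂ I := by
  rcases hB.2.1 I hI J hJ with h' | h' | h' | h'
  · exact Or.inr (Or.inl h')
  · exfalso
    have hd : Disjoint I J := Finset.disjoint_iff_inter_eq_empty.2 h'.1
    rcases h with h | h
    · exact Finset.disjoint_left.1 hd hn h
    · exact h'.2 (isInterval_union_of_touching hDev (hB.1 I hI) (hB.1 J hJ) hd hn h)
  · exact Or.inl h'.1
  · exact Or.inr (Or.inr h'.1)

theorem phi.exists_cover (hB : phi D B) {J : Finset (ZMod (D + 1))} (hJ : J ∈ B)
    {x : ZMod (D + 1)} (hx : x ∈ evSet D J) : ∃ C ∈ B, C ⊂ J ∧ x ∈ C := by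
  obtain ⟨𝒥, h1, h2, -, h4⟩ := hB.2.2 J hJ
  obtain ⟨C, hC, hxC⟩ := Finset.mem_biUnion.1 (h4 hx)
  exact ⟨C, h1 hC, (h2 C hC).1, hxC⟩

theorem phi.not_ssubset_of_start (hDev : Even D) (hB : phi D B) {K J : Finset (ZMod (D + 1))}
    (hK : K ∈ B) (hJ : J ∈ B) {n : ZMod (D + 1)} (hnJ : n ∉ J) (hnK : n + 1 ∈ K) : ¬ K ⊂ J := by
  intro hKJ
  obtain ⟨L, hL, hmax⟩ := (B.filter (fun L => n + 1 ∈ L ∧ L ⊂ J)).exists_max_image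
    Finset.card ⟨K, Finset.mem_filter.2 ⟨hK, hnK, hKJ⟩⟩
  obtain ⟨hLB, hnL, hLJ⟩ := Finset.mem_filter.1 hL
  obtain ⟨m, hm, hm', hev⟩ := exists_next_mem_evSet (hB.1 L hLB) (hB.1 J hJ) hLJ hnJ hnL
  obtain ⟨C, hC, hCJ, hmC⟩ := hB.exists_cover hJ hev
  rcases hB.comparable hDev hLB hC hm (Or.inr hmC) with h | rfl | h
  · exact (Finset.card_lt_card h).not_ge
      (hmax C (Finset.mem_filter.2 ⟨hC, h.1 hnL, hCJ⟩))
  · exact hm' hmC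
  · exact hm' (h.1 hmC)

theorem phi.not_ssubset_of_end (hDev : Even D) (hB : phi D B) {K J : Finset (ZMod (D + 1))}
    (hK : K ∈ B) (hJ : J ∈ B) {n : ZMod (D + 1)} (hnJ : n + 1 ∉ J) (hnK : n ∈ K) : ¬ K ⊂ J := by
  intro hKJ
  obtain ⟨L, hL, hmax⟩ := (B.filter (fun L => n ∈ L ∧ L ⊂ J)).exists_max_image
    Finset.card ⟨K, Finset.mem_filter.2 ⟨hK, hnK, hKJ⟩⟩
  obtain ⟨hLB, hnL, hLJ⟩ := Finset.mem_filter.1 hL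
  obtain ⟨m, hm, hm', hev⟩ := exists_prev_mem_evSet (hB.1 L hLB) (hB.1 J hJ) hLJ hnJ hnL
  obtain ⟨C, hC, hCJ, hmC⟩ := hB.exists_cover hJ hev
  rcases hB.comparable hDev hC hLB hmC (Or.inr hm) with h | rfl | h
  · exact hm' (h.1 hmC)
  · exact hm' hmC
  · exact (Finset.card_lt_card h).not_ge
      (hmax C (Finset.mem_filter.2 ⟨hC, h.1 hnL, hCJ⟩))

/-- No member of `B` starts right after another member ends. -/
theorem phi.not_start_end (hDev : Even D) (hB : phi D B) {I J : Finset (ZMod (D + 1))}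
    (hI : I ∈ B) (hJ : J ∈ B) {n : ZMod (D + 1)} (hnI : n ∉ I) (hnI' : n + 1 ∈ I)
    (hnJ : n ∈ J) : n + 1 ∈ J := by
  rcases hB.comparable hDev hJ hI hnJ (Or.inr hnI') with h | rfl | h
  · exact absurd (h.1 hnJ) hnI
  · exact hnI'
  · exact h.1 hnI'

theorem phi.eq_of_start (hDev : Even D) (hB : phi D B) {I J : Finset (ZMod (D + 1))}
    (hI : I ∈ B) (hJ : J ∈ B) {n : ZMod (D + 1)} (hnI : n ∉ I) (hnI' : n + 1 ∈ I)
    (hnJ : n ∉ J) (hnJ' : n + 1 ∈ J) : I = J := by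
  rcases hB.comparable hDev hI hJ hnI' (Or.inl hnJ') with h | h | h
  · exact absurd h (hB.not_ssubset_of_start hDev hI hJ hnJ hnI')
  · exact h
  · exact absurd h (hB.not_ssubset_of_start hDev hJ hI hnI hnJ')

theorem phi.eq_of_end (hDev : Even D) (hB : phi D B) {I J : Finset (ZMod (D + 1))}
    (hI : I ∈ B) (hJ : J ∈ B) {n : ZMod (D + 1)} (hnI : n ∈ I) (hnI' : n + 1 ∉ I)
    (hnJ : n ∈ J) (hnJ' : n + 1 ∉ J) : I = J := by
  rcases hB.comparable hDev hI hJ hnI (Or.inl hnJ) with h | h | h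
  · exact absurd h (hB.not_ssubset_of_end hDev hI hJ hnJ' hnI)
  · exact h
  · exact absurd h (hB.not_ssubset_of_end hDev hJ hI hnI' hnJ)

theorem phi.fam_of_start (hDev : Even D) (hB : phi D B) {I : Finset (ZMod (D + 1))}
    (hI : I ∈ B) {n : ZMod (D + 1)} (hn : n ∉ I) (hn' : n + 1 ∈ I) :
    fam B n = supers B I ∧ fam B (n + 1) = insert I (supers B I) := by
  have h1 : fam B n = supers B I := by
    ext J
    rw [mem_fam, mem_supers]
    refine and_congr_right fun hJ => ⟨fun h => ?_, fun h => ?_⟩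
    · have h' := hB.not_start_end hDev hI hJ hn hn' h
      rcases hB.comparable hDev hI hJ hn' (Or.inl h') with h2 | rfl | h2
      · exact h2
      · exact absurd h hn
      · exact absurd (h2.1 h) hn
    · by_contra h2
      exact hB.not_ssubset_of_start hDev hI hJ h2 hn' h
  refine ⟨h1, ?_⟩
  ext J
  rw [← h1, Finset.mem_insert, mem_fam, mem_fam]
  constructor
  · rintro ⟨hJ, h⟩
    by_cases hnJ : n ∈ J
    · exact Or.inr ⟨hJ, hnJ⟩
    · exact Or.inl (hB.eq_of_start hDev hJ hI hnJ h hn hn')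
  · rintro (rfl | ⟨hJ, h⟩)
    · exact ⟨hI, hn'⟩
    · exact ⟨hJ, hB.not_start_end hDev hI hJ hn hn' h⟩

theorem phi.fam_of_end (hDev : Even D) (hB : phi D B) {I : Finset (ZMod (D + 1))}
    (hI : I ∈ B) {n : ZMod (D + 1)} (hn : n ∈ I) (hn' : n + 1 ∉ I) :
    fam B (n + 1) = supers B I ∧ fam B n = insert I (supers B I) := by
  have key : ∀ J ∈ B, n + 1 ∈ J → n ∈ J := fun J hJ h => by
    by_contra h'
    exact hn' (hB.not_start_end hDev hJ hI h' h hn)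
  have h1 : fam B (n + 1) = supers B I := by
    ext J
    rw [mem_fam, mem_supers]
    refine and_congr_right fun hJ => ⟨fun h => ?_, fun h => ?_⟩
    · rcases hB.comparable hDev hI hJ hn (Or.inr h) with h2 | rfl | h2
      · exact h2
      · exact absurd h hn'
      · exact absurd (h2.1 h) hn'
    · by_contra h2
      exact hB.not_ssubset_of_end hDev hI hJ h2 hn h
  refine ⟨h1, ?_⟩
  ext J
  rw [← h1, Finset.mem_insert, mem_fam, mem_fam]
  constructor
  · rintro ⟨hJ, h⟩
    by_cases hnJ : n + 1 ∈ J
    · exact Or.inr ⟨hJ, hnJ⟩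
    · exact Or.inl (hB.eq_of_end hDev hJ hI h hnJ hn hn')
  · rintro (rfl | ⟨hJ, h⟩)
    · exact ⟨hI, hn⟩
    · exact ⟨hJ, key J hJ h⟩

/-- Either no member of `B` contains `n` or `n + 1`, or some member separates them. -/
theorem phi.fam_cases (hB : phi D B) (n : ZMod (D + 1)) :
    (fam B n = ∅ ∧ fam B (n + 1) = ∅) ∨ (∃ I ∈ B, n ∉ I ∧ n + 1 ∈ I) ∨
      ∃ I ∈ B, n ∈ I ∧ n + 1 ∉ I := by
  by_contra! h
  obtain ⟨h0, h1, h2⟩ := h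
  have hiff : ∀ I ∈ B, n ∈ I ↔ n + 1 ∈ I :=
    fun I hI => ⟨h2 I hI, fun h => by_contra fun h' => h1 I hI h' h⟩
  have heq : fam B (n + 1) = fam B n := Finset.filter_congr fun I hI => (hiff I hI).symm
  have hne : (fam B n).Nonempty := by
    by_contra h
    rw [Finset.not_nonempty_iff_eq_empty] at h
    exact (h0 h).ne_empty (heq.trans h)
  obtain ⟨I, hI, hmin⟩ := (fam B n).exists_min_image Finset.card hne
  obtain ⟨hIB, hnI⟩ := mem_fam.1 hI
  have hC : ∃ C ∈ B, C ⊂ I ∧ n ∈ C := by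
    rcases mem_evSet_or_add_one_mem (hB.1 I hIB) hnI ((hiff I hIB).1 hnI) with h | h
    · exact hB.exists_cover hIB h
    · obtain ⟨C, hC, hCI, hx⟩ := hB.exists_cover hIB h
      exact ⟨C, hC, hCI, (hiff C hC).2 hx⟩
  obtain ⟨C, hC, hCI, hnC⟩ := hC
  exact (Finset.card_lt_card hCI).not_ge (hmin C (mem_fam.2 ⟨hC, hnC⟩))

/-- The function `i ↦ g_i(B)` determines `B`. -/
theorem phi.subset_of_gB_eq (hDev : Even D) {B B' : Finset (Finset (ZMod (D + 1)))}
    (hB : phi D B) (hB' : phi D B') (h : ∀ i, (fam B i).card = (fam B' i).card) : B ⊆ B' := by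
  have key : ∀ {C : Finset (Finset (ZMod (D + 1)))}, phi D C → ∀ {i : ZMod (D + 1)} {l : ℕ},
      Odd l → l ≤ D → arc D i l ∈ C →
      (∀ t ∈ arc D i l, (fam C (i - 1)).card < (fam C t).card) ∧
        (fam C (i + l)).card = (fam C (i - 1)).card := by
    intro C hC i l hl hlD hmem
    have hi : i - 1 + 1 ∈ arc D i l := by
      simpa using add_natCast_mem_arc (D := D) (i := i) (t := 0) hl.pos
    have hstart := hC.fam_of_start hDev hmem (sub_one_notMem_arc hlD) hi
    have he : i + ((l - 1 : ℕ) : ZMod (D + 1)) + 1 = i + l := by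
      rw [Nat.cast_sub hl.pos]
      push_cast
      ring
    have hend := (hC.fam_of_end hDev hmem (add_natCast_mem_arc (by have := hl.pos; omega))
      (he ▸ add_length_notMem_arc hlD)).1
    rw [he] at hend
    refine ⟨fun t ht => ?_, by rw [hend, hstart.1]⟩
    rw [hstart.1]
    refine Finset.card_lt_card (Finset.ssubset_iff.2 ⟨_, notMem_supers_self _, ?_⟩)
    intro J hJ
    rcases Finset.mem_insert.1 hJ with rfl | hJ
    · exact mem_fam.2 ⟨hmem, ht⟩
    · exact mem_fam.2 ⟨(mem_supers.1 hJ).1, (mem_supers.1 hJ).2.1 ht⟩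
  intro I hI
  obtain ⟨i, l, hl, hlD, rfl⟩ := (hB.1 I hI).exists_arc
  obtain ⟨h1, h2⟩ := key hB hl hlD hI
  simp only [h] at h1 h2
  have hi : i ∈ arc D i l := by
    simpa using add_natCast_mem_arc (D := D) (i := i) (t := 0) hl.pos
  obtain ⟨K, hK⟩ : (fam B' i \ fam B' (i - 1)).Nonempty := by
    rw [Finset.sdiff_nonempty]
    exact fun hs => (h1 i hi).not_ge (Finset.card_le_card hs)
  rw [Finset.mem_sdiff, mem_fam, mem_fam] at hK
  obtain ⟨⟨hKB, hiK⟩, hiK'⟩ := hK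
  have hiK'' : i - 1 ∉ K := fun h => hiK' ⟨hKB, h⟩
  obtain ⟨j, k, hk, hkD, rfl⟩ := (hB'.1 K hKB).exists_arc
  have hj : j = i := by
    have := arc_start (by omega) hiK'' (by rwa [sub_add_cancel])
    rwa [sub_add_cancel] at this
  subst hj
  obtain ⟨h3, h4⟩ := key hB' hk hkD hKB
  rcases lt_trichotomy k l with hkl | rfl | hkl
  · exact absurd h4 (h1 _ (add_natCast_mem_arc hkl)).ne'
  · exact hKB
  · exact absurd h2 (h3 _ (add_natCast_mem_arc hkl)).ne'

end Families

section Paths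

variable {D : ℕ}

/-- The sign `1` for `1 : ZMod 2` and `-1` for `0`. -/
def signOf (z : ZMod 2) : ℤ := if z = 0 then -1 else 1

theorem signOf_natCast_add_one (l : ℕ) : signOf (l + 1) = (-1) ^ l := by
  rcases Nat.even_or_odd l with h | h
  · rw [h.neg_one_pow, (ZMod.natCast_eq_zero_iff_even).2 h]
    rfl
  · rw [h.neg_one_pow, (ZMod.natCast_eq_one_iff_odd).2 h]
    rfl

theorem abs_signOf (z : ZMod 2) : |signOf z| = 1 := by
  unfold signOf
  split_ifs <;> simp

/-- The path with values in the odd integers attached to `B` and a choice of coefficients `c`. It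
is antiperiodic, and its steps are determined by the element `∑ c_I e_I`. -/
def oddPath (B : Finset (Finset (ZMod (D + 1)))) (c : Finset (ZMod (D + 1)) → ZMod 2) (n : ℕ) : ℤ :=
  (-1) ^ (n + (fam B n).card) *
    (1 + 2 * ∑ I ∈ fam B n, (-1) ^ (supers B I).card * signOf (c I))

theorem oddPath_add_period (hDev : Even D) (B : Finset (Finset (ZMod (D + 1))))
    (c : Finset (ZMod (D + 1)) → ZMod 2) (n : ℕ) :
    oddPath B c (n + (D + 1)) = -oddPath B c n := by
  have h : ((n + (D + 1) : ℕ) : ZMod (D + 1)) = n := by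
    rw [Nat.cast_add, ZMod.natCast_self, add_zero]
  rw [oddPath, h, oddPath, show n + (D + 1) + (fam B n).card = n + (fam B n).card + (D + 1) by ring,
    pow_add _ _ (D + 1), hDev.add_one.neg_one_pow]
  ring

theorem oddPath_succ (hDev : Even D) {B : Finset (Finset (ZMod (D + 1)))} (hB : phi D B)
    (c : Finset (ZMod (D + 1)) → ZMod 2) (X : ZMod (D + 1) → ZMod 2)
    (hempty : ∀ m n, fam B m = ∅ → fam B n = ∅ → X m = X n)
    (hinsert : ∀ m n, ∀ I ∈ B, fam B n = supers B I → fam B m = insert I (supers B I) →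
      X m = X n + c I) (n : ℕ) :
    oddPath B c (n + 1) = oddPath B c n + 2 * (-1) ^ n * signOf (X (n + 1 : ℕ) - X n) := by
  have hsq : ∀ k : ℕ, ((-1 : ℤ) ^ k) * (-1) ^ k = 1 := fun k => by rw [← mul_pow]; simp
  rw [oddPath, oddPath]
  push_cast
  rcases hB.fam_cases (n : ZMod (D + 1)) with ⟨h1, h2⟩ | ⟨I, hI, hn, hn'⟩ | ⟨I, hI, hn, hn'⟩
  · rw [hempty _ _ h2 h1, h1, h2, sub_self]
    simp [signOf, pow_succ]
    ring
  · obtain ⟨h1, h2⟩ := hB.fam_of_start hDev hI hn hn'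
    rw [hinsert _ _ I hI h1 h2, h1, h2, Finset.card_insert_of_notMem (notMem_supers_self I),
      Finset.sum_insert (notMem_supers_self I), add_sub_cancel_left]
    simp only [pow_add, pow_one]
    linear_combination (2 * (-1) ^ n * signOf (c I)) * hsq (supers B I).card
  · obtain ⟨h1, h2⟩ := hB.fam_of_end hDev hI hn hn'
    rw [hinsert _ _ I hI h1 h2, h1, h2, Finset.card_insert_of_notMem (notMem_supers_self I),
      Finset.sum_insert (notMem_supers_self I), sub_add_cancel_left, ZMod.neg_eq_self_mod_two]
    simp only [pow_add, pow_one]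
    linear_combination (2 * (-1) ^ n * signOf (c I)) * hsq (supers B I).card

theorem abs_oddPath_le (B : Finset (Finset (ZMod (D + 1)))) (c : Finset (ZMod (D + 1)) → ZMod 2)
    (n : ℕ) : |oddPath B c n| ≤ 1 + 2 * (fam B n).card := by
  rw [oddPath, abs_mul, abs_pow, abs_neg, abs_one, one_pow, one_mul]
  have h : |∑ I ∈ fam B n, (-1) ^ (supers B I).card * signOf (c I)| ≤ ((fam B n).card : ℤ) := by
    refine (Finset.abs_sum_le_sum_abs _ _).trans ?_
    simp [abs_mul, abs_signOf]
  rw [abs_le] at h ⊢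
  omega

theorem abs_oddPath_level (B : Finset (Finset (ZMod (D + 1)))) (n : ℕ) :
    |oddPath B (fun I => (supers B I).card + 1) n| = 1 + 2 * (fam B n).card := by
  rw [oddPath, abs_mul, abs_pow, abs_neg, abs_one, one_pow, one_mul]
  simp only [signOf_natCast_add_one, ← mul_pow]
  simp only [mul_neg, mul_one, neg_neg, one_pow, Finset.sum_const, nsmul_eq_mul]
  exact abs_of_nonneg (by positivity)

theorem eq_of_antiperiodic {Q R s : ℕ → ℤ} {N : ℕ} (hQ : ∀ n, Q (n + 1) = Q n + s n)
    (hR : ∀ n, R (n + 1) = R n + s n) (hQN : ∀ n, Q (n + N) = -Q n)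
    (hRN : ∀ n, R (n + N) = -R n) (n : ℕ) : Q n = R n := by
  have h : ∀ n, Q n - R n = Q 0 - R 0 := by
    intro n
    induction n with
    | zero => rfl
    | succ n ih => rw [hQ, hR]; linarith
  have h1 := h n
  have h2 := h (n + N)
  rw [hQN, hRN] at h2
  linarith

theorem eSet_eq (I : Finset (ZMod (D + 1))) :
    eSet D I = Submodule.Quotient.mk (fun t => if t ∈ I then 1 else 0) := by
  rw [eSet]
  simp only [eV, ← Submodule.mkQ_apply]
  rw [← map_sum]
  congr 1
  ext t
  simp [Finset.sum_apply, Pi.single_apply]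

theorem epsB_eq (B : Finset (Finset (ZMod (D + 1)))) :
    epsB D B = Submodule.Quotient.mk
      (fun t => ((gB D B t * (gB D B t + 1) / 2 : ℕ) : ZMod 2)) := by
  rw [epsB]
  simp only [eV, ← Submodule.mkQ_apply, ← map_smul]
  rw [← map_sum]
  congr 1
  ext t
  simp [Finset.sum_apply, Pi.single_apply]

theorem exists_coeff_of_epsB_mem {B B' : Finset (Finset (ZMod (D + 1)))}
    (h : epsB D B' ∈ spanB D B) : ∃ (c : Finset (ZMod (D + 1)) → ZMod 2) (κ : ZMod 2), ∀ t,
      ((gB D B' t * (gB D B' t + 1) / 2 : ℕ) : ZMod 2) = κ + ∑ I ∈ fam B t, c I := by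
  rw [spanB, Submodule.mem_span_image_finset_iff_exists_fun'] at h
  obtain ⟨c, hc⟩ := h
  rw [epsB_eq] at hc
  simp only [eSet_eq, ← Submodule.mkQ_apply, ← map_smul] at hc
  rw [← map_sum, eq_comm, Submodule.mkQ_apply, Submodule.mkQ_apply, Submodule.Quotient.eq,
    Submodule.mem_span_singleton] at hc
  obtain ⟨κ, hκ⟩ := hc
  refine ⟨c, κ, fun t => ?_⟩
  have ht := congrFun hκ t
  simp only [allOnes, Pi.smul_apply, smul_eq_mul, mul_one, Pi.sub_apply, Finset.sum_apply,
    mul_ite, mul_zero] at ht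
  rw [fam, Finset.sum_filter, ht]
  ring

theorem triangle_succ (l : ℕ) :
    (((l + 1) * (l + 1 + 1) / 2 : ℕ) : ZMod 2) = ((l * (l + 1) / 2 : ℕ) : ZMod 2) + (l + 1) := by
  rw [show (l + 1) * (l + 1 + 1) = l * (l + 1) + (l + 1) * 2 by ring,
    Nat.add_mul_div_right _ _ two_pos]
  push_cast
  rfl

theorem gB_le_of_epsB_mem (hDev : Even D) {B B' : Finset (Finset (ZMod (D + 1)))} (hB : phi D B)
    (hB' : phi D B') (h : epsB D B' ∈ spanB D B) (i : ZMod (D + 1)) : gB D B' i ≤ gB D B i := by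
  obtain ⟨c, κ, hc⟩ := exists_coeff_of_epsB_mem h
  have key := eq_of_antiperiodic
    (oddPath_succ hDev hB c (fun t => κ + ∑ I ∈ fam B t, c I)
      (fun m n hm hn => by simp only [hm, hn])
      (fun m n I _ hn hm => by
        simp only [hm, hn, Finset.sum_insert (notMem_supers_self I)]
        ring))
    (by
      simp only [← hc]
      refine oddPath_succ hDev hB' (fun I => (supers B' I).card + 1)
        (fun t => ((gB D B' t * (gB D B' t + 1) / 2 : ℕ) : ZMod 2)) ?_ ?_
      · intro m n hm hn
        change ((((fam B' m).card * ((fam B' m).card + 1) / 2 : ℕ) : ZMod 2)) =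
          (((fam B' n).card * ((fam B' n).card + 1) / 2 : ℕ) : ZMod 2)
        rw [hm, hn]
      · intro m n I _ hn hm
        change ((((fam B' m).card * ((fam B' m).card + 1) / 2 : ℕ) : ZMod 2)) =
          (((fam B' n).card * ((fam B' n).card + 1) / 2 : ℕ) : ZMod 2) + _
        rw [hm, hn, Finset.card_insert_of_notMem (notMem_supers_self I), triangle_succ])
    (oddPath_add_period hDev B c) (oddPath_add_period hDev B' _) i.val
  have h1 := abs_oddPath_le B c i.val
  rw [key, abs_oddPath_level, ZMod.natCast_zmod_val] at h1
  change (fam B' i).card ≤ (fam B i).card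
  omega

theorem gB_mono (hDev : Even D) {B' B : Finset (Finset (ZMod (D + 1)))} (h : leφ D B' B)
    (i : ZMod (D + 1)) : gB D B' i ≤ gB D B i := by
  obtain ⟨k, c, rfl, rfl, hphi, hstep⟩ := h
  have : ∀ s ≤ k, gB D (c 0) i ≤ gB D (c s) i := by
    intro s
    induction s with
    | zero => exact fun _ => le_rfl
    | succ s ih =>
      exact fun hs => (ih (by omega)).trans
        (gB_le_of_epsB_mem hDev (hphi _ hs) (hphi _ (by omega)) (hstep s (by omega)) i)
  exact this k le_rfl

end Paths

theorem leφ.trans {D : ℕ} {B₁ B₂ B₃ : Finset (Finset (ZMod (D + 1)))} (h₁ : leφ D B₁ B₂)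
    (h₂ : leφ D B₂ B₃) : leφ D B₁ B₃ := by
  obtain ⟨k, c, rfl, rfl, hphi, hstep⟩ := h₁
  obtain ⟨l, d, hd, rfl, hphi', hstep'⟩ := h₂
  have hright : ∀ s, k ≤ s → (if s ≤ k then c s else d (s - k)) = d (s - k) := by
    intro s hs
    split_ifs with h
    · obtain rfl : s = k := by omega
      rw [Nat.sub_self, hd]
    · rfl
  refine ⟨k + l, fun s => if s ≤ k then c s else d (s - k), by simp, ?_, ?_, ?_⟩
  · exact (hright _ (Nat.le_add_right k l)).trans (by rw [Nat.add_sub_cancel_left])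
  · intro s hs
    by_cases h : s ≤ k
    · simpa only [if_pos h] using hphi s h
    · simpa only [if_neg h] using hphi' (s - k) (by omega)
  · intro s hs
    by_cases h : s < k
    · simpa only [if_pos h.le, if_pos (Nat.succ_le_of_lt h)] using hstep s h
    · simp only [hright s (by omega), hright (s + 1) (by omega)]
      rw [show s + 1 - k = s - k + 1 by omega]
      exact hstep' (s - k) (by omega)

/-- `≤` is a partial order on `φ(V_D)`: reflexive, transitive, antisymmetric. -/
theorem le_partialOrder (D : ℕ) (hD : 2 ≤ D) (hDev : Even D) :
    (∀ B, phi D B → leφ D B B) ∧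
    (∀ B₁ B₂ B₃, phi D B₁ → phi D B₂ → phi D B₃ →
      leφ D B₁ B₂ → leφ D B₂ B₃ → leφ D B₁ B₃) ∧
    (∀ B₁ B₂, phi D B₁ → phi D B₂ → leφ D B₁ B₂ → leφ D B₂ B₁ → B₁ = B₂) := by
  refine ⟨fun B hB => ⟨0, fun _ => B, rfl, rfl, fun _ _ => hB, fun s hs => absurd hs s.not_lt_zero⟩,
    fun B₁ B₂ B₃ _ _ _ h₁ h₂ => h₁.trans h₂, fun B₁ B₂ hB₁ hB₂ h₁ h₂ => ?_⟩
  have hg : ∀ i, (fam B₁ i).card = (fam B₂ i).card :=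
    fun i => le_antisymm (gB_mono hDev h₁ i) (gB_mono hDev h₂ i)
  exact (phi.subset_of_gB_eq hDev hB₁ hB₂ hg).antisymm
    (phi.subset_of_gB_eq hDev hB₂ hB₁ fun i => (hg i).symm)
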